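/- The map κ̂ : C̃(Γ_λ)/S_λ → C̃(BD_n^λ) defined by κ̂([c]) = κ(c), where κ is applied to oriented simplices by κ(a_1b_1 ∧ ... ∧ a_rb_r) = κ(a_1)κ(b_1) ∧ ... ∧ κ(a_r)κ(b_r) and extended linearly, is a well-defined isomorphism of chain complexes. -/

import Mathlib

set_option synthInstance.maxHeartbeats 1000000
set_option maxHeartbeats 1000000

noncomputable section

namespace MatchPaper

attribute [local instance 10] Classical.propDecidable

/-! ### Guarded constructions on additive groups -/

section AddGadgets

variable {A B : Type*} [AddCommGroup A] [AddCommGroup B]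

/-- Lift a homomorphism to the quotient (it genuinely descends whenever it kills `S`). -/
def liftOrZero (S : AddSubgroup A) (f : A →+ B) : A ⧸ S →+ B :=
  if h : S ≤ f.ker then QuotientAddGroup.lift S f h else 0

/-- Descend a homomorphism to quotients (genuine whenever `f S ≤ T`). -/
def descend (S : AddSubgroup A) (T : AddSubgroup B) (f : A →+ B) : A ⧸ S →+ B ⧸ T :=
  if h : S ≤ T.comap f then QuotientAddGroup.map S T f h else 0

/-- Restrict a homomorphism to subgroups (genuine whenever `f Z ≤ Z'`). -/
def restrictHom (f : A →+ B) (Z : AddSubgroup A) (Z' : AddSubgroup B) : Z →+ Z' :=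
  if h : ∀ x : Z, f x ∈ Z' then (f.comp Z.subtype).codRestrict Z' (fun x => h x) else 0

/-- The subquotient `Z / (Bd ∩ Z)`. -/
abbrev subQuot (Z Bd : AddSubgroup A) : Type _ := Z ⧸ Bd.addSubgroupOf Z

/-- The map induced by `f` on subquotients. -/
def subQuotMap (f : A →+ B) (Z Bd : AddSubgroup A) (Z' Bd' : AddSubgroup B) :
    subQuot Z Bd →+ subQuot Z' Bd' :=
  descend (Bd.addSubgroupOf Z) (Bd'.addSubgroupOf Z') (restrictHom f Z Z')

end AddGadgets

/-! ### Chain complexes of abelian groups, group actions, quotient and fixed-difference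
subcomplexes, and homology -/

section Abstract

variable (X : ℤ → Type*) [∀ i, AddCommGroup (X i)]

/-- Transport along an equality of indices. -/
def castAE {i j : ℤ} (h : i = j) : X i ≃+ X j := by subst h; exact AddEquiv.refl _

variable (d : ∀ i : ℤ, X (i + 1) →+ X i)

/-- The boundary map leaving degree `i`. -/
def dfrom (i : ℤ) : X i →+ X (i - 1) :=
  (d (i - 1)).comp (castAE X (show i = (i - 1) + 1 by ring)).toAddMonoidHom

/-- Cycles in degree `i`. -/
def cyc (i : ℤ) : AddSubgroup (X i) := (dfrom X d i).ker

/-- Boundaries in degree `i`. -/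
def bdr (i : ℤ) : AddSubgroup (X i) := (d i).range

/-- Homology of the chain complex `(X, d)` in degree `i`. -/
abbrev Hgrp (i : ℤ) : Type _ := subQuot (cyc X d i) (bdr X d i)

variable {G : Type*} [Group G] (act : G → ∀ i : ℤ, X i ≃+ X i)

/-- The subgroup `C_i^G` generated by the elements `c - g c`. -/
def gsub (i : ℤ) : AddSubgroup (X i) :=
  AddSubgroup.closure {x | ∃ (c : X i) (g : G), x = c - act g i c}

/-- The degree-`i` part of the quotient complex `C/G`. -/
abbrev QX (i : ℤ) : Type _ := X i ⧸ gsub X act i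

/-- The boundary map of the quotient complex `C/G`. -/
def qd (i : ℤ) : QX X act (i + 1) →+ QX X act i :=
  descend (gsub X act (i + 1)) (gsub X act i) (d i)

/-- Homology of the quotient complex `C/G`. -/
abbrev HQgrp (i : ℤ) : Type _ := Hgrp (QX X act) (qd X d act) i

/-- The boundary map of the subcomplex `C^G`. -/
def sd (i : ℤ) : gsub X act (i + 1) →+ gsub X act i :=
  restrictHom (d i) (gsub X act (i + 1)) (gsub X act i)

/-- Homology of the subcomplex `C^G`. -/
abbrev HSgrp (i : ℤ) : Type _ := Hgrp (fun j => gsub X act j) (sd X d act) i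

/-- The projection chain map `C → C/G`. -/
def projX (i : ℤ) : X i →+ QX X act i := QuotientAddGroup.mk' _

/-- The map `π*` induced on homology by the projection `C → C/G`. -/
def piStar (i : ℤ) : Hgrp X d i →+ HQgrp X d act i :=
  subQuotMap (projX X act i) (cyc X d i) (bdr X d i)
    (cyc (QX X act) (qd X d act) i) (bdr (QX X act) (qd X d act) i)

/-- The chain map `φ : C/G → C`, `[c] ↦ ∑ g • c`. -/
def phiX [Fintype G] (i : ℤ) : QX X act i →+ X i :=
  liftOrZero (gsub X act i) (∑ g : G, (act g i).toAddMonoidHom)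

/-- The map `φ*` induced on homology by `φ`. -/
def phiStar [Fintype G] (i : ℤ) : HQgrp X d act i →+ Hgrp X d i :=
  subQuotMap (phiX X act i) (cyc (QX X act) (qd X d act) i) (bdr (QX X act) (qd X d act) i)
    (cyc X d i) (bdr X d i)

end Abstract

/-! ### Guarded constructions on modules -/

section LinGadgets

variable (R : Type*) [CommRing R] {M N : Type*} [AddCommGroup M] [Module R M]
  [AddCommGroup N] [Module R N]

def liftOrZeroL (S : Submodule R M) (f : M →ₗ[R] N) : (M ⧸ S) →ₗ[R] N :=
  if h : S ≤ LinearMap.ker f then S.liftQ f h else 0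

def descendL (S : Submodule R M) (T : Submodule R N) (f : M →ₗ[R] N) :
    (M ⧸ S) →ₗ[R] (N ⧸ T) :=
  if h : S ≤ T.comap f then S.mapQ T f h else 0

def restrictL (f : M →ₗ[R] N) (Z : Submodule R M) (Z' : Submodule R N) : Z →ₗ[R] Z' :=
  if h : ∀ x ∈ Z, f x ∈ Z' then f.restrict h else 0

/-- The subquotient `Z / (Bd ∩ Z)`. -/
abbrev subQuotL (Z Bd : Submodule R M) : Type _ := Z ⧸ Bd.comap Z.subtype

def subQuotMapL (f : M →ₗ[R] N) (Z Bd : Submodule R M) (Z' Bd' : Submodule R N) :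
    subQuotL R Z Bd →ₗ[R] subQuotL R Z' Bd' :=
  descendL R (Bd.comap Z.subtype) (Bd'.comap Z'.subtype) (restrictL R f Z Z')

end LinGadgets

/-! ### Reduced simplicial chains and homology of a family of finite sets

A family `K : Finset V → Prop` of finite subsets of a vertex type `V` (in our applications a
simplicial complex, in particular closed under taking subsets and containing `∅`) has reduced
simplicial chain groups over a ring `R`: the degree-`d` chain group is free on the faces of
cardinality `d + 1`, i.e. we index chain groups by the cardinality `c = d + 1` of the faces,
with the empty face (cardinality `0`, degree `-1`) giving the augmentation.  Orientations are
induced by an injection `rank : V → ℕ` of the vertices into `ℕ`. -/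

section Simplicial

variable (R : Type*) [CommRing R]

/-- Chains on the faces of cardinality `c` of the family `K`. -/
abbrev SChain {V : Type*} (K : Finset V → Prop) (c : ℕ) : Type _ :=
  {σ : Finset V // K σ ∧ σ.card = c} →₀ R

/-- The basis chain of a face, or zero for a non-face. -/
def basisOrZero {V : Type*} (K : Finset V → Prop) (c : ℕ) (τ : Finset V) : SChain R K c :=
  if h : K τ ∧ τ.card = c then Finsupp.single ⟨τ, h⟩ (1 : R) else 0

/-- The simplicial boundary map, with signs determined by the ordering of the vertices via
`rank`. -/
def bdry {V : Type*} [DecidableEq V] (rank : V → ℕ) (K : Finset V → Prop) (c : ℕ) :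
    SChain R K (c + 1) →ₗ[R] SChain R K c :=
  Finsupp.lsum R fun σ => LinearMap.toSpanSingleton R _
    (∑ v ∈ σ.1, ((-1 : ℤ) ^ ((σ.1.filter fun u => rank u < rank v).card) •
      basisOrZero R K c (σ.1.erase v)))

/-- The orientation sign of a map `f` on a face `σ`: the parity of the number of inversions. -/
def mapSign {V W : Type*} (rank : V → ℕ) (rank' : W → ℕ) (f : V → W) (σ : Finset V) : ℤ :=
  (-1) ^ (((σ ×ˢ σ).filter fun p => rank p.1 < rank p.2 ∧ rank' (f p.2) < rank' (f p.1)).card)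

/-- The chain map induced by a map `f` on vertices, taking orientations into account. -/
def chainMap {V W : Type*} [DecidableEq V] [DecidableEq W] (rank : V → ℕ) (rank' : W → ℕ)
    (f : V → W) (K : Finset V → Prop) (K' : Finset W → Prop) (c : ℕ) :
    SChain R K c →ₗ[R] SChain R K' c :=
  Finsupp.lsum R fun σ => LinearMap.toSpanSingleton R _
    (mapSign rank rank' f σ.1 • basisOrZero R K' c (σ.1.image f))

/-- Cycles among the chains on faces of cardinality `c` (for `c = 0` everything is a cycle:
the boundary map leaving degree `-1` is zero). -/
def cycLow {V : Type*} [DecidableEq V] (rank : V → ℕ) (K : Finset V → Prop) :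
    (c : ℕ) → Submodule R (SChain R K c)
  | 0 => ⊤
  | (m + 1) => LinearMap.ker (bdry R rank K m)

/-- Reduced simplicial homology at the faces of cardinality `c`, i.e. in degree `c - 1`. -/
abbrev RHc {V : Type*} [DecidableEq V] (rank : V → ℕ) (K : Finset V → Prop) (c : ℕ) : Type _ :=
  subQuotL R (cycLow R rank K c) (LinearMap.range (bdry R rank K c))

/-- Reduced simplicial homology `H̃_dg(K; R)`. -/
abbrev RH {V : Type*} [DecidableEq V] (rank : V → ℕ) (K : Finset V → Prop) (dg : ℕ) : Type _ :=
  RHc R rank K (dg + 1)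

end Simplicial

/-! ### The matching complex and the complexes of graphs of bounded degree -/

/-- The standard injection of pairs into `ℕ`, inducing the lexicographic order. -/
def rankP (m : ℕ) : Fin m × Fin m → ℕ := fun p => p.1.val * m + p.2.val

/-- A face of the matching complex `M_m`: a set of edges `(i, j)`, `i < j`, of the complete
graph on `Fin m`, no two of which share an endpoint. -/
def IsMatching (m : ℕ) (σ : Finset (Fin m × Fin m)) : Prop :=
  (∀ p ∈ σ, p.1 < p.2) ∧
    ∀ p ∈ σ, ∀ q ∈ σ, p ≠ q → p.1 ≠ q.1 ∧ p.1 ≠ q.2 ∧ p.2 ≠ q.1 ∧ p.2 ≠ q.2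

/-- `H̃_dg(M_m; R)`, the reduced homology of the matching complex on `m` vertices. -/
abbrev MH (R : Type*) [CommRing R] (m dg : ℕ) : Type _ := RH R (rankP m) (IsMatching m) dg

/-- The degree of the vertex `i` in the graph `σ` (a loop `(i, i)` counts twice). -/
def degB {n : ℕ} (σ : Finset (Fin n × Fin n)) (i : Fin n) : ℕ :=
  ∑ p ∈ σ, ((if p.1 = i then 1 else 0) + (if p.2 = i then 1 else 0))

/-- A face of `BD_n^λ`: a graph on `Fin n` (loops allowed, encoded as pairs `(i, j)` with
`i ≤ j`) in which the vertex `i` has degree at most `λ i`. -/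
def IsBDGraph {n : ℕ} (lam : Fin n → ℕ) (σ : Finset (Fin n × Fin n)) : Prop :=
  (∀ p ∈ σ, p.1 ≤ p.2) ∧ ∀ i, degB σ i ≤ lam i

/-- `H̃_dg(BD_n^λ; R)`. -/
abbrev BDH (R : Type*) [CommRing R] {n : ℕ} (lam : Fin n → ℕ) (dg : ℕ) : Type _ :=
  RH R (rankP n) (IsBDGraph lam) dg

/-! ### The Young group action on the matching complex -/

/-- The action of a permutation of the vertices on the edges of the complete graph. -/
def emap {m : ℕ} (g : Equiv.Perm (Fin m)) : Fin m × Fin m → Fin m × Fin m :=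
  fun p => (min (g p.1) (g p.2), max (g p.1) (g p.2))

/-- The quotient map on edges induced by a surjection `kap` on vertices (whose fibers are the
blocks `U_i` of the partition). -/
def kmap {N n : ℕ} (kap : Fin N → Fin n) : Fin N × Fin N → Fin n × Fin n :=
  fun p => (min (kap p.1) (kap p.2), max (kap p.1) (kap p.2))

/-- Membership of a permutation in the Young group: it preserves each block of the partition
determined by `kap`. -/
def KeepsBlocks {N n : ℕ} (kap : Fin N → Fin n) (g : Equiv.Perm (Fin N)) : Prop :=
  ∀ x, kap (g x) = kap x

section YoungAction

variable (R : Type*) [CommRing R]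

/-- The action of a permutation `g` of the `N` vertices on chains. -/
def actC (N : ℕ) (K : Finset (Fin N × Fin N) → Prop) (g : Equiv.Perm (Fin N)) (c : ℕ) :
    SChain R K c →ₗ[R] SChain R K c :=
  chainMap R (rankP N) (rankP N) (emap g) K K c

/-- The submodule of chains generated by the elements `c - g c`, `g` in the Young group. -/
def ysub (N n : ℕ) (kap : Fin N → Fin n) (K : Finset (Fin N × Fin N) → Prop) (c : ℕ) :
    Submodule R (SChain R K c) :=
  Submodule.span R {x | ∃ (ch : SChain R K c) (g : Equiv.Perm (Fin N)),
    KeepsBlocks kap g ∧ x = ch - actC R N K g c ch}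

/-- The chains of the quotient complex `C̃/S_λ`. -/
abbrev QC (N n : ℕ) (kap : Fin N → Fin n) (K : Finset (Fin N × Fin N) → Prop) (c : ℕ) :
    Type _ :=
  SChain R K c ⧸ ysub R N n kap K c

/-- The boundary map of the quotient complex `C̃/S_λ`. -/
def qbdry (N n : ℕ) (kap : Fin N → Fin n) (K : Finset (Fin N × Fin N) → Prop) (c : ℕ) :
    QC R N n kap K (c + 1) →ₗ[R] QC R N n kap K c :=
  descendL R (ysub R N n kap K (c + 1)) (ysub R N n kap K c) (bdry R (rankP N) K c)

/-- Homology of the quotient complex `C̃(M_N)/S_λ` in degree `dg`. -/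
abbrev QMH (N n : ℕ) (kap : Fin N → Fin n) (dg : ℕ) : Type _ :=
  subQuotL R (LinearMap.ker (qbdry R N n kap (IsMatching N) dg))
    (LinearMap.range (qbdry R N n kap (IsMatching N) (dg + 1)))

/-- The chain map `φ : C̃/S_λ → C̃`, `[c] ↦ ∑_{g ∈ S_λ} g c`. -/
def phiC (N n : ℕ) (kap : Fin N → Fin n) (K : Finset (Fin N × Fin N) → Prop) (c : ℕ) :
    QC R N n kap K c →ₗ[R] SChain R K c :=
  liftOrZeroL R (ysub R N n kap K c)
    (∑ g ∈ Finset.univ.filter (fun g : Equiv.Perm (Fin N) => ∀ x, kap (g x) = kap x),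
      actC R N K g c)

/-- The map `φ* : H_dg(C̃(M_N)/S_λ) → H̃_dg(M_N; R)` induced by `φ`. -/
def phiStarM (N n : ℕ) (kap : Fin N → Fin n) (dg : ℕ) :
    QMH R N n kap dg →ₗ[R] MH R N dg :=
  subQuotMapL R (phiC R N n kap (IsMatching N) (dg + 1))
    (LinearMap.ker (qbdry R N n kap (IsMatching N) dg))
    (LinearMap.range (qbdry R N n kap (IsMatching N) (dg + 1)))
    (cycLow R (rankP N) (IsMatching N) (dg + 1))
    (LinearMap.range (bdry R (rankP N) (IsMatching N) (dg + 1)))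

end YoungAction

/-! ### The subfamilies `Δ_λ` and `Γ_λ` of the matching complex -/

/-- `σ` contains two distinct edges `ab`, `cd` with `a, c` in the same block and `b, d` in the
same block. -/
def InDelta {N n : ℕ} (kap : Fin N → Fin n) (σ : Finset (Fin N × Fin N)) : Prop :=
  ∃ p ∈ σ, ∃ q ∈ σ, p ≠ q ∧
    ((kap p.1 = kap q.1 ∧ kap p.2 = kap q.2) ∨ (kap p.1 = kap q.2 ∧ kap p.2 = kap q.1))

/-- A face of `Δ_λ`. -/
def IsDelta {N n : ℕ} (kap : Fin N → Fin n) (σ : Finset (Fin N × Fin N)) : Prop :=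
  IsMatching N σ ∧ InDelta kap σ

/-- A face of `Γ_λ = M_N \ Δ_λ`. -/
def IsGamma {N n : ℕ} (kap : Fin N → Fin n) (σ : Finset (Fin N × Fin N)) : Prop :=
  IsMatching N σ ∧ ¬ InDelta kap σ

section YoungMore

variable (R : Type*) [CommRing R]

/-- The map `κ̂ : C̃(Γ_λ)/S_λ → C̃(BD_n^λ)`, `[c] ↦ κ(c)`. -/
def khat (N n : ℕ) (kap : Fin N → Fin n) (lam : Fin n → ℕ) (c : ℕ) :
    QC R N n kap (IsGamma kap) c →ₗ[R] SChain R (IsBDGraph lam) c :=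
  liftOrZeroL R (ysub R N n kap (IsGamma kap) c)
    (chainMap R (rankP N) (rankP n) (kmap kap) (IsGamma kap) (IsBDGraph lam) c)

/-- The boundary map of the subcomplex `C̃(M_N; R)^{S_λ}`. -/
def sbdry (N n : ℕ) (kap : Fin N → Fin n) (c : ℕ) :
    ysub R N n kap (IsMatching N) (c + 1) →ₗ[R] ysub R N n kap (IsMatching N) c :=
  restrictL R (bdry R (rankP N) (IsMatching N) c)
    (ysub R N n kap (IsMatching N) (c + 1)) (ysub R N n kap (IsMatching N) c)

/-- Homology of the subcomplex `C̃(M_N; R)^{S_λ}` in degree `dg`: the cycles of the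
subcomplex (elements of the subcomplex with vanishing boundary) modulo the boundaries of
elements of the subcomplex. -/
abbrev SubH (N n : ℕ) (kap : Fin N → Fin n) (dg : ℕ) : Type _ :=
  subQuotL R
    (ysub R N n kap (IsMatching N) (dg + 1) ⊓ cycLow R (rankP N) (IsMatching N) (dg + 1))
    ((ysub R N n kap (IsMatching N) (dg + 1 + 1)).map (bdry R (rankP N) (IsMatching N) (dg + 1)))

/-! ### Inclusion maps between matching complexes -/

/-- The chain map induced by the inclusion `M_m ⊆ M_{m'}`. -/
def inclChain (m m' : ℕ) (h : m ≤ m') (c : ℕ) :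
    SChain R (IsMatching m) c →ₗ[R] SChain R (IsMatching m') c :=
  chainMap R (rankP m) (rankP m') (fun p => (Fin.castLE h p.1, Fin.castLE h p.2))
    (IsMatching m) (IsMatching m') c

/-- The map `H̃_dg(M_m; R) → H̃_dg(M_{m'}; R)` induced by the inclusion. -/
def inclStar (m m' : ℕ) (h : m ≤ m') (dg : ℕ) : MH R m dg →ₗ[R] MH R m' dg :=
  subQuotMapL R (inclChain R m m' h (dg + 1))
    (cycLow R (rankP m) (IsMatching m) (dg + 1))
    (LinearMap.range (bdry R (rankP m) (IsMatching m) (dg + 1)))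
    (cycLow R (rankP m') (IsMatching m') (dg + 1))
    (LinearMap.range (bdry R (rankP m') (IsMatching m') (dg + 1)))

/-! ### The pair `(M_m, M_m \ e)`, where `e` is the last edge -/

/-- The edge `e` between the last two of the `m` vertices. -/
def eEdge (m : ℕ) (h : 2 ≤ m) : Fin m × Fin m := (⟨m - 2, by omega⟩, ⟨m - 1, by omega⟩)

/-- A face of `M_m \ e`: a matching not containing the edge `e`. -/
def MnMinusE (m : ℕ) (h : 2 ≤ m) (σ : Finset (Fin m × Fin m)) : Prop :=
  IsMatching m σ ∧ eEdge m h ∉ σ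

/-- Pass from a set of edges avoiding the last two vertices of `Fin m` to a set of edges on
`Fin (m - 2)`. -/
def shrink (m : ℕ) (σ : Finset (Fin m × Fin m)) : Finset (Fin (m - 2) × Fin (m - 2)) :=
  (σ.filter fun p => p.1.val < m - 2 ∧ p.2.val < m - 2).attach.image
    fun p => (⟨p.1.1.val, (Finset.mem_filter.mp p.2).2.1⟩,
              ⟨p.1.2.val, (Finset.mem_filter.mp p.2).2.2⟩)

/-- The chain map realizing the composition
`C̃(M_m) → C̃(M_m, M_m \ e) ≅ C̃(M_{m - 2})[1]`: a face `σ` containing `e` is written as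
`σ = ± e ∧ w` and sent to `± w`, viewed in the matching complex on the remaining `m - 2`
vertices; a face not containing `e` is sent to zero. -/
def theta (m : ℕ) (hm : 2 ≤ m) (c : ℕ) :
    SChain R (IsMatching m) (c + 1) →ₗ[R] SChain R (IsMatching (m - 2)) c :=
  Finsupp.lsum R fun σ => LinearMap.toSpanSingleton R _
    (if eEdge m hm ∈ σ.1 then
      ((-1 : ℤ) ^ c) • basisOrZero R (IsMatching (m - 2)) c (shrink m (σ.1.erase (eEdge m hm)))
     else 0)

/-- The map `H̃_dg(M_m \ e; R) → H̃_dg(M_m; R)` induced by the inclusion. -/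
def inclEStar (m : ℕ) (hm : 2 ≤ m) (dg : ℕ) :
    RH R (rankP m) (MnMinusE m hm) dg →ₗ[R] MH R m dg :=
  subQuotMapL R (chainMap R (rankP m) (rankP m) id (MnMinusE m hm) (IsMatching m) (dg + 1))
    (cycLow R (rankP m) (MnMinusE m hm) (dg + 1))
    (LinearMap.range (bdry R (rankP m) (MnMinusE m hm) (dg + 1)))
    (cycLow R (rankP m) (IsMatching m) (dg + 1))
    (LinearMap.range (bdry R (rankP m) (IsMatching m) (dg + 1)))

/-- The composition `H̃_dg(M_m; R) → H_dg(M_m, M_m \ e; R) ≅ H̃_{dg - 1}(M_{m - 2}; R)` of the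
map to relative homology with the canonical isomorphism. -/
def thetaStar (m : ℕ) (hm : 2 ≤ m) (dg : ℕ) :
    MH R m dg →ₗ[R] RHc R (rankP (m - 2)) (IsMatching (m - 2)) dg :=
  subQuotMapL R (theta R m hm dg)
    (cycLow R (rankP m) (IsMatching m) (dg + 1))
    (LinearMap.range (bdry R (rankP m) (IsMatching m) (dg + 1)))
    (cycLow R (rankP (m - 2)) (IsMatching (m - 2)) dg)
    (LinearMap.range (bdry R (rankP (m - 2)) (IsMatching (m - 2)) dg))

end YoungMore

end MatchPaper

end

namespace MatchPaper

/-! ### Counting inversions -/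

lemma mapSign_eq {V W : Type*} (r : V → ℕ) (r' : W → ℕ) (f : V → W) (σ : Finset V) :
    mapSign r r' f σ =
      (-1) ^ (∑ x ∈ σ, ∑ y ∈ σ, if r x < r y ∧ r' (f y) < r' (f x) then 1 else 0) := by
  unfold mapSign
  rw [Finset.card_filter, Finset.sum_product]

lemma inv_comp {V : Type*} (σ : Finset V) (a b c : V → ℕ)
    (ha : Set.InjOn a σ) (hb : Set.InjOn b σ) (hc : Set.InjOn c σ) :
    ∃ X : ℕ, (∑ x ∈ σ, ∑ y ∈ σ, if a x < a y ∧ b y < b x then 1 else 0) +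
      (∑ x ∈ σ, ∑ y ∈ σ, if b x < b y ∧ c y < c x then 1 else 0) =
      (∑ x ∈ σ, ∑ y ∈ σ, if a x < a y ∧ c y < c x then 1 else 0) + 2 * X := by
  refine ⟨∑ x ∈ σ, ∑ y ∈ σ, if a x < a y ∧ b y < b x ∧ c x < c y then 1 else 0, ?_⟩
  have h2 : (∑ x ∈ σ, ∑ y ∈ σ, if a x < a y ∧ b y < b x ∧ c x < c y then 1 else 0) =
    ∑ x ∈ σ, ∑ y ∈ σ, if a y < a x ∧ b x < b y ∧ c y < c x then 1 else 0 := Finset.sum_comm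
  rw [two_mul]
  nth_rewrite 2 [h2]
  simp only [← Finset.sum_add_distrib]
  refine Finset.sum_congr rfl fun x hx => Finset.sum_congr rfl fun y hy => ?_
  by_cases hxy : x = y
  · subst hxy; simp
  · have h1 : a x ≠ a y := fun h => hxy (ha hx hy h)
    have h2 : b x ≠ b y := fun h => hxy (hb hx hy h)
    have h3 : c x ≠ c y := fun h => hxy (hc hx hy h)
    split_ifs <;> omega

lemma mapSign_comp {V W U : Type*} [DecidableEq W] (r : V → ℕ) (r' : W → ℕ) (r'' : U → ℕ)
    (hr : Function.Injective r) (hr' : Function.Injective r') (hr'' : Function.Injective r'')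
    (f : V → W) (h : W → U) (σ : Finset V) (hhf : Set.InjOn (h ∘ f) σ) :
    mapSign r r'' (h ∘ f) σ = mapSign r r' f σ * mapSign r' r'' h (σ.image f) := by
  have hf : Set.InjOn f σ := fun x hx y hy e => hhf hx hy (congrArg h e)
  rw [mapSign_eq, mapSign_eq, mapSign_eq, ← pow_add, Finset.sum_image hf]
  simp only [Finset.sum_image hf]
  obtain ⟨X, hX⟩ := inv_comp σ r (fun x => r' (f x)) (fun x => r'' (h (f x)))
    hr.injOn (fun x hx y hy e => hf hx hy (hr' e)) (fun x hx y hy e => hhf hx hy (hr'' e))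
  rw [hX, pow_add, pow_mul]
  simp

lemma mapSign_sq {V W : Type*} (r : V → ℕ) (r' : W → ℕ) (f : V → W) (σ : Finset V) :
    mapSign r r' f σ * mapSign r r' f σ = 1 := by
  unfold mapSign
  rw [← pow_add, ← two_mul, pow_mul]; simp

lemma mapSign_erase {V W : Type*} [DecidableEq V] [DecidableEq W] (r : V → ℕ) (r' : W → ℕ)
    (hr : Function.Injective r) (hr' : Function.Injective r')
    (f : V → W) (σ : Finset V) (hf : Set.InjOn f σ) (v : V) (hv : v ∈ σ) :
    mapSign r r' f σ * (-1) ^ (((σ.image f).filter fun w => r' w < r' (f v)).card) =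
      (-1) ^ ((σ.filter fun u => r u < r v).card) * mapSign r r' f (σ.erase v) := by
  obtain ⟨s, hvs, rfl⟩ : ∃ s, v ∉ s ∧ σ = insert v s :=
    ⟨σ.erase v, by simp, by simp [hv]⟩
  rw [Finset.erase_insert hvs, mapSign_eq, mapSign_eq, Finset.card_filter, Finset.card_filter,
    Finset.sum_image hf, ← pow_add, ← pow_add]
  simp only [Finset.sum_insert hvs, Finset.sum_add_distrib]
  simp only [lt_irrefl, false_and, if_false, zero_add]
  have key : (∑ y ∈ s, if r v < r y ∧ r' (f y) < r' (f v) then 1 else 0) +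
      (∑ x ∈ s, if r x < r v ∧ r' (f v) < r' (f x) then 1 else 0) +
      (∑ x ∈ s, if r' (f x) < r' (f v) then 1 else 0) =
      (∑ x ∈ s, if r x < r v then 1 else 0) +
      2 * (∑ x ∈ s, if r v < r x ∧ r' (f x) < r' (f v) then 1 else 0) := by
    rw [two_mul]
    simp only [← Finset.sum_add_distrib]
    refine Finset.sum_congr rfl fun x hx => ?_
    have hxv : x ≠ v := fun e => hvs (e ▸ hx)
    have h1 : r x ≠ r v := fun h => hxv (hr h)
    have h2 : r' (f x) ≠ r' (f v) := fun h =>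
      hxv (hf (Finset.mem_coe.2 (Finset.mem_insert_of_mem hx)) (Finset.mem_coe.2 (Finset.mem_insert_self _ _)) (hr' h))
    split_ifs <;> omega
  set A := ∑ x ∈ s, ∑ y ∈ s, if r x < r y ∧ r' (f y) < r' (f x) then 1 else 0
  have : ∀ a b c d e : ℕ, a + b + c = d + 2 * e →
      (-1 : ℤ) ^ (a + (b + A) + c) = (-1) ^ (d + A) := by
    intro a b c d e h
    rw [show a + (b + A) + c = (d + A) + 2 * e by omega, pow_add, pow_mul]; simp
  exact this _ _ _ _ _ key

/-! ### Generic chain maps -/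

lemma chainMap_single {V W : Type*} [DecidableEq V] [DecidableEq W] (r : V → ℕ) (r' : W → ℕ)
    (f : V → W) (K : Finset V → Prop) (K' : Finset W → Prop) (c : ℕ)
    (σ : {σ : Finset V // K σ ∧ σ.card = c}) :
    chainMap ℤ r r' f K K' c (Finsupp.single σ 1) =
      mapSign r r' f σ.1 • basisOrZero ℤ K' c (σ.1.image f) := by
  simp [chainMap]

lemma chainMap_basis {V W : Type*} [DecidableEq V] [DecidableEq W] (r : V → ℕ) (r' : W → ℕ)
    (f : V → W) (K : Finset V → Prop) (K' : Finset W → Prop) (c : ℕ)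
    (σ : Finset V) (h : K σ ∧ σ.card = c) :
    chainMap ℤ r r' f K K' c (basisOrZero ℤ K c σ) =
      mapSign r r' f σ • basisOrZero ℤ K' c (σ.image f) := by
  rw [basisOrZero, dif_pos h, chainMap_single]

lemma bdry_basis {V : Type*} [DecidableEq V] (r : V → ℕ)
    (K : Finset V → Prop) (c : ℕ) (σ : Finset V) (h : K σ ∧ σ.card = c + 1) :
    bdry ℤ r K c (basisOrZero ℤ K (c + 1) σ) =
      ∑ v ∈ σ, ((-1 : ℤ) ^ ((σ.filter fun u => r u < r v).card) •
        basisOrZero ℤ K c (σ.erase v)) := by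
  rw [basisOrZero, dif_pos h]
  simp [bdry]

lemma ext_basis {V : Type*} {M : Type*} [AddCommGroup M] (K : Finset V → Prop) (c : ℕ)
    (F G : SChain ℤ K c →ₗ[ℤ] M)
    (h : ∀ σ, K σ ∧ σ.card = c → F (basisOrZero ℤ K c σ) = G (basisOrZero ℤ K c σ)) :
    F = G := by
  refine Finsupp.lhom_ext' fun σ => LinearMap.ext_ring ?_
  have := h σ.1 σ.2
  rw [basisOrZero, dif_pos σ.2] at this
  exact this

lemma bdry_chainMap {V W : Type*} [DecidableEq V] [DecidableEq W] (r : V → ℕ) (r' : W → ℕ)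
    (hr : Function.Injective r) (hr' : Function.Injective r')
    (f : V → W) (K : Finset V → Prop) (K' : Finset W → Prop)
    (hK : ∀ σ v, K σ → K (σ.erase v)) (hf : ∀ σ, K σ → Set.InjOn f σ)
    (hKK : ∀ σ, K σ → K' (σ.image f)) (c : ℕ) (x : SChain ℤ K (c + 1)) :
    bdry ℤ r' K' c (chainMap ℤ r r' f K K' (c + 1) x) =
      chainMap ℤ r r' f K K' c (bdry ℤ r K c x) := by
  rw [← LinearMap.comp_apply, ← LinearMap.comp_apply]
  congr 1
  apply ext_basis
  rintro σ hσ
  have hinj := hf σ hσ.1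
  rw [LinearMap.comp_apply, LinearMap.comp_apply, chainMap_basis _ _ _ _ _ _ _ hσ,
    bdry_basis _ _ _ _ hσ, map_smul, bdry_basis _ _ _ _
      ⟨hKK _ hσ.1, (Finset.card_image_of_injOn hinj).trans hσ.2⟩, map_sum,
    Finset.sum_image hinj, Finset.smul_sum]
  refine Finset.sum_congr rfl fun v hv => ?_
  rw [map_smul, chainMap_basis _ _ _ _ _ _ _ ⟨hK _ _ hσ.1, by
    rw [Finset.card_erase_of_mem hv, hσ.2]; rfl⟩, smul_smul, smul_smul,
    mapSign_erase r r' hr hr' f σ hinj v hv]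
  congr 2
  ext w
  simp only [Finset.mem_erase, Finset.mem_image]
  constructor
  · rintro ⟨h1, u, hu, rfl⟩
    exact ⟨u, ⟨fun e => h1 (e ▸ rfl), hu⟩, rfl⟩
  · rintro ⟨u, ⟨h1, hu⟩, rfl⟩
    exact ⟨fun e => h1 (hinj hu hv e), u, hu, rfl⟩

lemma chainMap_comp {V W U : Type*} [DecidableEq V] [DecidableEq W] [DecidableEq U]
    (r : V → ℕ) (r' : W → ℕ) (r'' : U → ℕ)
    (hr : Function.Injective r) (hr' : Function.Injective r') (hr'' : Function.Injective r'')
    (f : V → W) (h : W → U) (K : Finset V → Prop) (K' : Finset W → Prop) (K'' : Finset U → Prop)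
    (hf : ∀ σ, K σ → Set.InjOn (h ∘ f) σ)
    (hKK : ∀ σ, K σ → K' (σ.image f)) (c : ℕ) (x : SChain ℤ K c) :
    chainMap ℤ r' r'' h K' K'' c (chainMap ℤ r r' f K K' c x) =
      chainMap ℤ r r'' (h ∘ f) K K'' c x := by
  rw [← LinearMap.comp_apply]
  congr 1
  apply ext_basis
  rintro σ hσ
  have hinj := hf σ hσ.1
  have hfi : Set.InjOn f σ := fun x hx y hy e => hinj hx hy (congrArg h e)
  rw [LinearMap.comp_apply, chainMap_basis _ _ _ _ _ _ _ hσ, map_smul,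
    chainMap_basis _ _ _ _ _ _ _ ⟨hKK _ hσ.1, (Finset.card_image_of_injOn hfi).trans hσ.2⟩,
    chainMap_basis _ _ _ _ _ _ _ hσ, smul_smul, mapSign_comp r r' r'' hr hr' hr'' f h σ hinj,
    Finset.image_image]

/-! ### Combinatorics of the edges -/

lemma rankP_injective (m : ℕ) : Function.Injective (rankP m) := by
  rintro ⟨a, b⟩ ⟨c, d⟩ h
  simp only [rankP] at h
  have hm : 0 < m := lt_of_le_of_lt (Nat.zero_le _) a.2
  have h1 := congrArg (· % m) h
  have h2 := congrArg (· / m) h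
  simp only [Nat.mul_add_mod_of_lt b.2, Nat.mul_add_mod_of_lt d.2] at h1
  have : a.val = c.val := by
    rw [h1] at h
    exact Nat.eq_of_mul_eq_mul_right hm (by omega)
  exact Prod.ext (Fin.ext this) (Fin.ext h1)

lemma minmax_eq {n : ℕ} {a b c d : Fin n}
    (h : ((min a b, max a b) : Fin n × Fin n) = (min c d, max c d)) :
    (a = c ∧ b = d) ∨ (a = d ∧ b = c) := by
  rw [Prod.mk.injEq] at h
  obtain ⟨h1, h2⟩ := h
  rcases le_total a b with h3 | h3 <;> rcases le_total c d with h4 | h4 <;>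
    simp [h3, h4] at h1 h2 <;> simp [h1, h2]

lemma minmax_cases {n : ℕ} (a b : Fin n) :
    (min a b = a ∧ max a b = b) ∨ (min a b = b ∧ max a b = a) := by
  rcases le_total a b with h3 | h3 <;> simp [h3]

lemma kmap_eq_iff {N n : ℕ} (kap : Fin N → Fin n) (p q : Fin N × Fin N) :
    kmap kap p = kmap kap q ↔
    ((kap p.1 = kap q.1 ∧ kap p.2 = kap q.2) ∨ (kap p.1 = kap q.2 ∧ kap p.2 = kap q.1)) := by
  constructor
  · exact minmax_eq
  · rintro (⟨h1, h2⟩ | ⟨h1, h2⟩)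
    · simp [kmap, h1, h2]
    · simp [kmap, h1, h2, min_comm, max_comm]

lemma gamma_iff {N n : ℕ} (kap : Fin N → Fin n) (σ : Finset (Fin N × Fin N)) :
    IsGamma kap σ ↔ IsMatching N σ ∧ Set.InjOn (kmap kap) σ := by
  unfold IsGamma InDelta
  refine and_congr_right fun _ => ?_
  constructor
  · intro h p hp q hq e
    by_contra hne
    exact h ⟨p, hp, q, hq, hne, (kmap_eq_iff kap p q).1 e⟩
  · rintro h ⟨p, hp, q, hq, hne, e⟩
    exact hne (h hp hq ((kmap_eq_iff kap p q).2 e))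

lemma gamma_erase {N n : ℕ} (kap : Fin N → Fin n) (σ : Finset (Fin N × Fin N)) (v)
    (h : IsGamma kap σ) : IsGamma kap (σ.erase v) := by
  have hs : ∀ {p}, p ∈ σ.erase v → p ∈ σ := fun hp => Finset.mem_of_mem_erase hp
  refine ⟨⟨fun p hp => h.1.1 p (hs hp), fun p hp q hq => h.1.2 p (hs hp) q (hs hq)⟩, ?_⟩
  rintro ⟨p, hp, q, hq, hh⟩
  exact h.2 ⟨p, hs hp, q, hs hq, hh⟩

/-- endpoint -/
def ept {m : ℕ} (h : (Fin m × Fin m) × Bool) : Fin m := if h.2 then h.1.2 else h.1.1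

lemma ept_injOn {m : ℕ} {σ : Finset (Fin m × Fin m)} (h : IsMatching m σ) :
    Set.InjOn (ept (m := m)) (σ ×ˢ (Finset.univ : Finset Bool) : Finset _) := by
  rintro ⟨p, b⟩ hp ⟨q, b'⟩ hq e
  simp only [Finset.coe_product, Set.mem_prod, Finset.mem_coe] at hp hq
  have h1 := h.1 p hp.1
  have h1' := h.1 q hq.1
  have h2 := h.2 p hp.1 q hq.1
  by_cases hpq : p = q
  · subst hpq
    cases b <;> cases b' <;> simp [ept] at e <;> first | rfl | (rw [e] at h1; exact absurd h1 (lt_irrefl _))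
  · obtain ⟨a1, a2, a3, a4⟩ := h2 hpq
    cases b <;> cases b' <;> simp [ept] at e <;> contradiction

/-- A matching from an injective family of half-edges. -/
lemma matching_of_inj {N : ℕ} {H : Type*} [DecidableEq H] (S : Finset H) (e : H × Bool → Fin N)
    (he : Set.InjOn e (S ×ˢ (Finset.univ : Finset Bool) : Finset _)) :
    IsMatching N (S.image fun p => (min (e (p, false)) (e (p, true)),
      max (e (p, false)) (e (p, true)))) := by
  have key : ∀ p ∈ S, ∀ q ∈ S, ∀ b b', e (p, b) = e (q, b') → p = q ∧ b = b' := by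
    intro p hp q hq b b' h
    have := @he (p, b) (by simpa using hp) (q, b') (by simpa using hq) h
    simpa using this
  constructor
  · intro p hp
    replace hp := Finset.mem_image.1 hp
    obtain ⟨p, hp, rfl⟩ := hp
    simp only
    rw [min_lt_max]
    intro h
    simpa using (key p hp p hp _ _ h).2
  · intro p hp q hq hne
    replace hp := Finset.mem_image.1 hp
    obtain ⟨p, hp, rfl⟩ := hp
    replace hq := Finset.mem_image.1 hq
    obtain ⟨q, hq, rfl⟩ := hq
    have hpq : p ≠ q := fun h => hne (h ▸ rfl)
    have key' : ∀ b b', e (p, b) ≠ e (q, b') := fun b b' h => hpq (key p hp q hq b b' h).1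
    simp only
    rcases minmax_cases (e (p, false)) (e (p, true)) with ⟨h1, h2⟩ | ⟨h1, h2⟩ <;>
    rcases minmax_cases (e (q, false)) (e (q, true)) with ⟨h3, h4⟩ | ⟨h3, h4⟩ <;>
    rw [h1, h2, h3, h4] <;> exact ⟨key' _ _, key' _ _, key' _ _, key' _ _⟩

lemma emap_ept {N : ℕ} (g : Equiv.Perm (Fin N)) (σ : Finset (Fin N × Fin N)) :
    σ.image (emap g) = σ.image (fun p => (min (g (ept (p, false))) (g (ept (p, true))),
      max (g (ept (p, false))) (g (ept (p, true))))) := rfl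

lemma kmap_emap {N n : ℕ} (kap : Fin N → Fin n) (g : Equiv.Perm (Fin N))
    (hg : KeepsBlocks kap g) : kmap kap ∘ emap g = kmap kap := by
  funext p
  simp only [Function.comp, emap]
  rcases minmax_cases (g p.1) (g p.2) with ⟨h1, h2⟩ | ⟨h1, h2⟩ <;>
    rw [h1, h2] <;> simp [kmap, hg _, min_comm, max_comm]

lemma gamma_emap {N n : ℕ} (kap : Fin N → Fin n) (g : Equiv.Perm (Fin N))
    (hg : KeepsBlocks kap g) (σ : Finset (Fin N × Fin N)) (h : IsGamma kap σ) :
    IsGamma kap (σ.image (emap g)) := by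
  rw [gamma_iff] at h ⊢
  constructor
  · rw [emap_ept]
    exact matching_of_inj σ (fun h => g (ept h)) (fun x hx y hy e => ept_injOn h.1 hx hy (g.injective e))
  · intro p hp q hq e
    replace hp := Finset.mem_image.1 (Finset.mem_coe.1 hp)
    obtain ⟨p, hp, rfl⟩ := hp
    replace hq := Finset.mem_image.1 (Finset.mem_coe.1 hq)
    obtain ⟨q, hq, rfl⟩ := hq
    have h1 := congrFun (kmap_emap kap g hg) p
    have h2 := congrFun (kmap_emap kap g hg) q
    simp only [Function.comp] at h1 h2
    rw [h1, h2] at e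
    rw [h.2 hp hq e]

lemma degB_eq {n : ℕ} (σ : Finset (Fin n × Fin n)) (i : Fin n) :
    degB σ i = ((σ ×ˢ (Finset.univ : Finset Bool)).filter fun h => ept h = i).card := by
  rw [Finset.card_filter, Finset.sum_product]
  unfold degB
  refine Finset.sum_congr rfl fun p _ => ?_
  rw [Fintype.sum_bool, add_comm]
  simp [ept]

lemma gamma_bd {N n : ℕ} (kap : Fin N → Fin n) (lam : Fin n → ℕ)
    (hcard : ∀ i : Fin n, (Finset.univ.filter fun x => kap x = i).card = lam i)
    (σ : Finset (Fin N × Fin N)) (h : IsGamma kap σ) :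
    IsBDGraph lam (σ.image (kmap kap)) := by
  rw [gamma_iff] at h
  constructor
  · intro p hp
    replace hp := Finset.mem_image.1 hp
    obtain ⟨p, hp, rfl⟩ := hp
    simp [kmap]
  · intro i
    have : degB (σ.image (kmap kap)) i =
        ((σ ×ˢ (Finset.univ : Finset Bool)).filter fun h => kap (ept h) = i).card := by
      rw [Finset.card_filter, Finset.sum_product]
      unfold degB
      rw [Finset.sum_image h.2]
      refine Finset.sum_congr rfl fun p _ => ?_
      rw [Fintype.sum_bool]
      have e1 : (kmap kap p).1 = min (kap p.1) (kap p.2) := rfl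
      have e2 : (kmap kap p).2 = max (kap p.1) (kap p.2) := rfl
      have e3 : ept (p, true) = p.2 := rfl
      have e4 : ept (p, false) = p.1 := rfl
      simp only [e1, e2, e3, e4]
      rcases minmax_cases (kap p.1) (kap p.2) with ⟨h1, h2⟩ | ⟨h1, h2⟩ <;> simp only [h1, h2] <;>
        simp [add_comm]
    rw [this, ← hcard i]
    refine Finset.card_le_card_of_injOn ept ?_ ?_
    · intro x hx
      simpa using (Finset.mem_filter.1 hx).2
    · exact (ept_injOn h.1).mono (Finset.coe_subset.2 (Finset.filter_subset _ _))

lemma exists_lift {N n : ℕ} (kap : Fin N → Fin n) {H : Type*} [DecidableEq H] (col : H → Fin n)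
    (S : Finset H) (e0 : H → Fin N)
    (hS : ∀ i, (S.filter fun h => col h = i).card ≤ (Finset.univ.filter fun x => kap x = i).card) :
    ∃ e : H → Fin N, Set.InjOn e S ∧ ∀ h ∈ S, kap (e h) = col h := by
  induction S using Finset.induction_on with
  | empty => exact ⟨e0, by simp, by simp⟩
  | insert h S hh ih =>
    obtain ⟨e, he, hk⟩ := ih fun i =>
      (Finset.card_le_card (Finset.filter_subset_filter _ (Finset.subset_insert _ _))).trans (hS i)
    have hlt : ((S.filter fun h' => col h' = col h).image e).card <
        (Finset.univ.filter fun x => kap x = col h).card := by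
      refine lt_of_le_of_lt Finset.card_image_le (lt_of_lt_of_le ?_ (hS (col h)))
      apply Finset.card_lt_card
      rw [Finset.filter_insert, if_pos rfl]
      exact Finset.ssubset_insert (by simp [hh])
    obtain ⟨x, hx, hx'⟩ := Finset.exists_mem_notMem_of_card_lt_card hlt
    have hxk : kap x = col h := (Finset.mem_filter.1 hx).2
    have hxS : ∀ h' ∈ S, e h' ≠ x := by
      intro h' h'S hex
      refine hx' (Finset.mem_image.2 ⟨h', Finset.mem_filter.2 ⟨h'S, ?_⟩, hex⟩)
      rw [← hk h' h'S, hex, hxk]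
    have hu : ∀ h' ∈ S, Function.update e h x h' = e h' := fun h' h'S =>
      Function.update_of_ne (fun e1 => hh (by rw [← e1]; exact h'S)) _ _
    refine ⟨Function.update e h x, ?_, ?_⟩
    · intro a ha b hb hab
      replace ha := Finset.mem_insert.1 (Finset.mem_coe.1 ha)
      replace hb := Finset.mem_insert.1 (Finset.mem_coe.1 hb)
      rcases ha with rfl | ha <;> rcases hb with rfl | hb
      · rfl
      · rw [hu b hb, Function.update_self] at hab
        exact absurd hab.symm (hxS b hb)
      · rw [hu a ha, Function.update_self] at hab
        exact absurd hab (hxS a ha)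
      · rw [hu a ha, hu b hb] at hab
        exact he ha hb hab
    · intro a ha
      rcases Finset.mem_insert.1 ha with rfl | ha
      · simpa using hxk
      · rw [hu a ha, hk a ha]

lemma exists_gamma {N n : ℕ} (kap : Fin N → Fin n) (lam : Fin n → ℕ)
    (hcard : ∀ i : Fin n, (Finset.univ.filter fun x => kap x = i).card = lam i)
    (σ : Finset (Fin n × Fin n)) (h : IsBDGraph lam σ) :
    ∃ τ, IsGamma kap τ ∧ τ.image (kmap kap) = σ := by
  rcases σ.eq_empty_or_nonempty with rfl | ⟨p0, hp0⟩
  · exact ⟨∅, by simp [IsGamma, IsMatching, InDelta], by simp⟩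
  have hS : ∀ i, ((σ ×ˢ (Finset.univ : Finset Bool)).filter fun h => ept h = i).card ≤
      (Finset.univ.filter fun x => kap x = i).card := by
    intro i
    rw [← degB_eq, hcard i]
    exact h.2 i
  have hne : Nonempty (Fin N) := by
    have h1 := hS (ept (p0, false))
    have h2 : 0 < ((σ ×ˢ (Finset.univ : Finset Bool)).filter
        fun h => ept h = ept (p0, false)).card :=
      Finset.card_pos.2 ⟨(p0, false), by simp [hp0]⟩
    obtain ⟨x, _⟩ := Finset.card_pos.1 (lt_of_lt_of_le h2 h1)
    exact ⟨x⟩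
  obtain ⟨e, he, hk⟩ := exists_lift kap ept (σ ×ˢ (Finset.univ : Finset Bool))
    (fun _ => hne.some) hS
  have hkm : ∀ p ∈ σ, kmap kap (min (e (p, false)) (e (p, true)),
      max (e (p, false)) (e (p, true))) = p := by
    intro p hp
    have h1 : kap (e (p, false)) = p.1 := by rw [hk (p, false) (by simp [hp])]; simp [ept]
    have h2 : kap (e (p, true)) = p.2 := by rw [hk (p, true) (by simp [hp])]; simp [ept]
    have h3 := h.1 p hp
    rcases minmax_cases (e (p, false)) (e (p, true)) with ⟨h4, h5⟩ | ⟨h4, h5⟩ <;>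
      rw [h4, h5] <;> simp [kmap, h1, h2, h3]
  refine ⟨_, (gamma_iff _ _).2 ⟨matching_of_inj σ e he, ?_⟩, ?_⟩
  · intro p hp q hq e
    replace hp := Finset.mem_image.1 (Finset.mem_coe.1 hp)
    obtain ⟨p, hp, rfl⟩ := hp
    replace hq := Finset.mem_image.1 (Finset.mem_coe.1 hq)
    obtain ⟨q, hq, rfl⟩ := hq
    rw [hkm p hp, hkm q hq] at e
    rw [e]
  · rw [Finset.image_image]
    ext p
    simp only [Finset.mem_image, Function.comp]
    constructor
    · rintro ⟨q, hq, rfl⟩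
      rw [hkm q hq]; exact hq
    · intro hp
      exact ⟨p, hp, hkm p hp⟩

lemma exists_perm {N n : ℕ} (kap : Fin N → Fin n) {H : Type*} [DecidableEq H]
    (S : Finset H) (e e' : H → Fin N) (he : Set.InjOn e S) (he' : Set.InjOn e' S)
    (hk : ∀ h ∈ S, kap (e h) = kap (e' h)) :
    ∃ g : Equiv.Perm (Fin N), KeepsBlocks kap g ∧ ∀ h ∈ S, g (e h) = e' h := by
  induction S using Finset.induction_on with
  | empty => exact ⟨1, fun _ => rfl, by simp⟩
  | insert h S hh ih =>
    obtain ⟨g, hg, hge⟩ := ih (he.mono (by simp)) (he'.mono (by simp))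
      (fun h' h'S => hk h' (Finset.mem_insert_of_mem h'S))
    have hhk := hk h (Finset.mem_insert_self _ _)
    refine ⟨g.trans (Equiv.swap (g (e h)) (e' h)), ?_, ?_⟩
    · intro x
      rw [Equiv.trans_apply, Equiv.swap_apply_def]
      split_ifs with h1 h2
      · rw [← hhk, ← hg (e h), ← h1, hg]
      · rw [hg, hhk, ← h2, hg]
      · exact hg x
    · intro a ha
      rcases Finset.mem_insert.1 ha with rfl | ha'
      · simp
      · have hne : a ≠ h := fun e => hh (e ▸ ha')
        have hm : h ∈ insert h S := Finset.mem_insert_self _ _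
        rw [Equiv.trans_apply, Equiv.swap_apply_of_ne_of_ne, hge a ha']
        · intro e1
          exact hne (he ha hm (g.injective e1))
        · intro e1
          rw [hge a ha'] at e1
          exact hne (he' ha hm e1)

lemma exists_young {N n : ℕ} (kap : Fin N → Fin n) (τ τ' : Finset (Fin N × Fin N))
    (h : IsGamma kap τ) (h' : IsGamma kap τ') (hh : τ.image (kmap kap) = τ'.image (kmap kap)) :
    ∃ g : Equiv.Perm (Fin N), KeepsBlocks kap g ∧ τ.image (emap g) = τ' := by
  rw [gamma_iff] at h h'
  have h1 : ∀ p : Fin N × Fin N, ∃ e : Bool → Fin N, p ∈ τ →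
      ((∀ b, kap (e b) = kap (ept (p, b))) ∧
        (min (e false) (e true), max (e false) (e true)) ∈ τ') := by
    intro p
    by_cases hp : p ∈ τ
    · have : kmap kap p ∈ τ'.image (kmap kap) := hh ▸ Finset.mem_image_of_mem _ hp
      obtain ⟨q, hq, hqp⟩ := Finset.mem_image.1 this
      have hlt := (h'.1.1 q hq).le
      rcases (kmap_eq_iff _ _ _).1 hqp with ⟨h1, h2⟩ | ⟨h1, h2⟩
      · refine ⟨fun b => if b then q.2 else q.1, fun _ => ⟨?_, ?_⟩⟩
        · rintro (_ | _) <;> simp [ept, h1, h2]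
        · simpa [hlt] using hq
      · refine ⟨fun b => if b then q.1 else q.2, fun _ => ⟨?_, ?_⟩⟩
        · rintro (_ | _) <;> simp [ept, h1, h2]
        · simpa [hlt] using hq
    · exact ⟨fun _ => p.1, fun h => absurd h hp⟩
  choose e he using h1
  have hkm : ∀ p ∈ τ, kmap kap (min (e p false) (e p true), max (e p false) (e p true)) =
      kmap kap p := by
    intro p hp
    have h1 : kap (e p false) = kap p.1 := (he p hp).1 false
    have h2 : kap (e p true) = kap p.2 := (he p hp).1 true
    rcases minmax_cases (e p false) (e p true) with ⟨h4, h5⟩ | ⟨h4, h5⟩ <;>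
      rw [h4, h5] <;> simp [kmap, h1, h2, min_comm, max_comm]
  have hinj : Set.InjOn (fun x : (Fin N × Fin N) × Bool => e x.1 x.2)
      (τ ×ˢ (Finset.univ : Finset Bool) : Finset _) := by
    rintro ⟨p, b⟩ hp ⟨q, b'⟩ hq hpq
    simp only [Finset.coe_product, Set.mem_prod, Finset.mem_coe] at hp hq hpq
    have hp1 := (he p hp.1).2
    have hq1 := (he q hq.1).2
    by_cases hpq' : p = q
    · subst hpq'
      have hlt := h'.1.1 _ hp1
      simp only [min_lt_max] at hlt
      cases b <;> cases b' <;> first | rfl | exact absurd hpq hlt | exact absurd hpq.symm hlt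
    · exfalso
      have hne : ((min (e p false) (e p true), max (e p false) (e p true)) : Fin N × Fin N) ≠
          (min (e q false) (e q true), max (e q false) (e q true)) := by
        intro h3
        refine hpq' (h.2 hp.1 hq.1 ?_)
        rw [← hkm p hp.1, h3, hkm q hq.1]
      have h4 := h'.1.2 _ hp1 _ hq1 hne
      simp only at h4
      rcases minmax_cases (e p false) (e p true) with ⟨a1, a2⟩ | ⟨a1, a2⟩ <;>
      rcases minmax_cases (e q false) (e q true) with ⟨a3, a4⟩ | ⟨a3, a4⟩ <;>
      rw [a1, a2, a3, a4] at h4 <;> obtain ⟨b1, b2, b3, b4⟩ := h4 <;>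
      cases b <;> cases b' <;> contradiction
  obtain ⟨g, hg, hge⟩ := exists_perm kap (τ ×ˢ (Finset.univ : Finset Bool)) ept
    (fun x => e x.1 x.2) (ept_injOn h.1) hinj (fun x hx => ((he x.1 (by simpa using hx)).1 x.2).symm)
  refine ⟨g, hg, ?_⟩
  have hsub : τ.image (emap g) ⊆ τ' := by
    intro q hq
    rw [emap_ept] at hq
    obtain ⟨p, hp, rfl⟩ := Finset.mem_image.1 hq
    rw [hge (p, false) (by simp [hp]), hge (p, true) (by simp [hp])]
    exact (he p hp).2
  refine Finset.eq_of_subset_of_card_le hsub ?_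
  rw [← Finset.card_image_of_injOn h'.2, ← hh, ← kmap_emap kap g hg, ← Finset.image_image]
  exact Finset.card_image_le

/-! ### The main argument -/

lemma actC_kmap {N n : ℕ} (kap : Fin N → Fin n) (lam : Fin n → ℕ) (c : ℕ)
    (g : Equiv.Perm (Fin N)) (hg : KeepsBlocks kap g) (x : SChain ℤ (IsGamma kap) c) :
    chainMap ℤ (rankP N) (rankP n) (kmap kap) (IsGamma kap) (IsBDGraph lam) c
      (actC ℤ N (IsGamma kap) g c x) =
    chainMap ℤ (rankP N) (rankP n) (kmap kap) (IsGamma kap) (IsBDGraph lam) c x := by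
  unfold actC
  rw [chainMap_comp _ _ _ (rankP_injective _) (rankP_injective _) (rankP_injective _), kmap_emap kap g hg]
  · intro σ hσ
    rw [kmap_emap kap g hg]
    exact ((gamma_iff _ _).1 hσ).2
  · exact gamma_emap kap g hg

lemma ysub_le_ker {N n : ℕ} (kap : Fin N → Fin n) (lam : Fin n → ℕ) (c : ℕ) :
    ysub ℤ N n kap (IsGamma kap) c ≤ LinearMap.ker
      (chainMap ℤ (rankP N) (rankP n) (kmap kap) (IsGamma kap) (IsBDGraph lam) c) := by
  refine Submodule.span_le.2 ?_
  rintro _ ⟨ch, g, hg, rfl⟩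
  rw [SetLike.mem_coe, LinearMap.mem_ker, map_sub, actC_kmap kap lam c g hg, sub_self]

lemma khat_mk {N n : ℕ} (kap : Fin N → Fin n) (lam : Fin n → ℕ) (c : ℕ)
    (x : SChain ℤ (IsGamma kap) c) :
    khat ℤ N n kap lam c (Submodule.Quotient.mk x) =
        chainMap ℤ (rankP N) (rankP n) (kmap kap) (IsGamma kap) (IsBDGraph lam) c x := by
  unfold khat liftOrZeroL
  rw [dif_pos (ysub_le_ker kap lam c)]
  rfl

lemma ysub_le_comap {N n : ℕ} (kap : Fin N → Fin n) (c : ℕ) :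
    ysub ℤ N n kap (IsGamma kap) (c + 1) ≤
      (ysub ℤ N n kap (IsGamma kap) c).comap (bdry ℤ (rankP N) (IsGamma kap) c) := by
  refine Submodule.span_le.2 ?_
  rintro _ ⟨ch, g, hg, rfl⟩
  rw [SetLike.mem_coe, Submodule.mem_comap, map_sub]
  refine Submodule.subset_span ⟨bdry ℤ (rankP N) (IsGamma kap) c ch, g, hg, ?_⟩
  unfold actC
  rw [bdry_chainMap _ _ (rankP_injective _) (rankP_injective _) _ _ _ (gamma_erase kap) _
    (gamma_emap kap g hg)]
  intro σ hσ x hx y hy e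
  refine ((gamma_iff _ _).1 hσ).2 hx hy ?_
  have h1 := congrArg (kmap kap) e
  have h2 := kmap_emap kap g hg
  rwa [← Function.comp_apply (f := kmap kap), ← Function.comp_apply (f := kmap kap), h2] at h1

lemma qbdry_mk {N n : ℕ} (kap : Fin N → Fin n) (c : ℕ)
    (x : SChain ℤ (IsGamma kap) (c + 1)) :
    qbdry ℤ N n kap (IsGamma kap) c (Submodule.Quotient.mk x) =
      Submodule.Quotient.mk (bdry ℤ (rankP N) (IsGamma kap) c x) := by
  unfold qbdry descendL
  rw [dif_pos (ysub_le_comap kap c)]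
  rfl

lemma mk_act {N n : ℕ} (kap : Fin N → Fin n) (c : ℕ) (g : Equiv.Perm (Fin N))
    (hg : KeepsBlocks kap g) (x : SChain ℤ (IsGamma kap) c) :
    (Submodule.Quotient.mk x : QC ℤ N n kap (IsGamma kap) c) =
      Submodule.Quotient.mk (actC ℤ N (IsGamma kap) g c x) :=
  (Submodule.Quotient.eq _).2 (Submodule.subset_span ⟨x, g, hg, rfl⟩)

lemma gamma_card {N n : ℕ} {kap : Fin N → Fin n} {σ : Finset (Fin N × Fin N)}
    (h : IsGamma kap σ) : (σ.image (kmap kap)).card = σ.card :=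
  Finset.card_image_of_injOn ((gamma_iff _ _).1 h).2

lemma khat_bijective {N n : ℕ} (kap : Fin N → Fin n) (lam : Fin n → ℕ)
    (hcard : ∀ i : Fin n, (Finset.univ.filter fun x => kap x = i).card = lam i) (c : ℕ) :
    Function.Bijective (khat ℤ N n kap lam c) := by
  choose s hs hs' using exists_gamma kap lam hcard
  let psi : SChain ℤ (IsBDGraph lam) c →ₗ[ℤ] QC ℤ N n kap (IsGamma kap) c :=
    Finsupp.lsum ℤ fun σ => LinearMap.toSpanSingleton ℤ _
      (mapSign (rankP N) (rankP n) (kmap kap) (s σ.1 σ.2.1) •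
        (Submodule.Quotient.mk (basisOrZero ℤ (IsGamma kap) c (s σ.1 σ.2.1)) :
          QC ℤ N n kap (IsGamma kap) c))
  have hpsi : ∀ σ (h : IsBDGraph lam σ ∧ σ.card = c), psi (basisOrZero ℤ (IsBDGraph lam) c σ) =
      mapSign (rankP N) (rankP n) (kmap kap) (s σ h.1) •
        (Submodule.Quotient.mk (basisOrZero ℤ (IsGamma kap) c (s σ h.1)) :
          QC ℤ N n kap (IsGamma kap) c) := by
    intro σ h
    rw [basisOrZero, dif_pos h]
    simp [psi]
  have hsc : ∀ σ (h : IsBDGraph lam σ), (s σ h).card = σ.card := by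
    intro σ h
    rw [← gamma_card (hs σ h), hs' σ h]
  have h1 : (khat ℤ N n kap lam c).comp psi = LinearMap.id := by
    apply ext_basis
    intro σ h
    rw [LinearMap.comp_apply, hpsi σ h, map_smul, khat_mk, chainMap_basis _ _ _ _ _ _ _
      ⟨hs σ h.1, (hsc σ h.1).trans h.2⟩, smul_smul, mapSign_sq, one_smul, hs' σ h.1]
    rfl
  have h2 : (psi.comp (khat ℤ N n kap lam c)).comp (Submodule.mkQ _) = Submodule.mkQ _ := by
    apply ext_basis
    intro τ h
    have hb : IsBDGraph lam (τ.image (kmap kap)) := gamma_bd kap lam hcard τ h.1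
    have hbc : (τ.image (kmap kap)).card = c := (gamma_card h.1).trans h.2
    rw [LinearMap.comp_apply, LinearMap.comp_apply, Submodule.mkQ_apply, khat_mk,
      chainMap_basis _ _ _ _ _ _ _ h, map_smul, hpsi _ ⟨hb, hbc⟩]
    obtain ⟨g, hg, hge⟩ := exists_young kap τ (s _ hb) h.1 (hs _ hb) (hs' _ hb).symm
    rw [mk_act kap c g hg (basisOrZero ℤ (IsGamma kap) c τ)]
    unfold actC
    rw [chainMap_basis _ _ _ _ _ _ _ h, hge, Submodule.Quotient.mk_smul, smul_smul]
    congr 1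
    have h3 := mapSign_comp (rankP N) (rankP N) (rankP n) (rankP_injective _) (rankP_injective _)
      (rankP_injective _) (emap g) (kmap kap) τ
      (by rw [kmap_emap kap g hg]; exact ((gamma_iff _ _).1 h.1).2)
    rw [kmap_emap kap g hg, hge] at h3
    rw [h3, mul_assoc, mapSign_sq, mul_one]
  constructor
  · refine Function.LeftInverse.injective (g := psi) fun x => ?_
    obtain ⟨x, rfl⟩ := Submodule.mkQ_surjective _ x
    exact LinearMap.congr_fun h2 x
  · exact Function.RightInverse.surjective (g := psi) fun x => LinearMap.congr_fun h1 x

end MatchPaper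

open MatchPaper in
/-- The map `κ̂ : C̃(Γ_λ)/S_λ → C̃(BD_n^λ)`, `κ̂([c]) = κ(c)`, is a
well-defined isomorphism of chain complexes. -/
theorem khat_chain_complex_isomorphism
    (N n : ℕ) (lam : Fin n → ℕ) (kap : Fin N → Fin n)
    (hcard : ∀ i : Fin n, (Finset.univ.filter fun x => kap x = i).card = lam i) :
    (∀ (c : ℕ) (x : SChain ℤ (IsGamma kap) c),
      khat ℤ N n kap lam c (Submodule.Quotient.mk x) =
        chainMap ℤ (rankP N) (rankP n) (kmap kap) (IsGamma kap) (IsBDGraph lam) c x) ∧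
    (∀ c : ℕ, Function.Bijective (khat ℤ N n kap lam c)) ∧
    ∀ (c : ℕ) (x : QC ℤ N n kap (IsGamma kap) (c + 1)),
      bdry ℤ (rankP n) (IsBDGraph lam) c (khat ℤ N n kap lam (c + 1) x) =
        khat ℤ N n kap lam c (qbdry ℤ N n kap (IsGamma kap) c x) := by
  refine ⟨fun c x => khat_mk kap lam c x, fun c => khat_bijective kap lam hcard c, ?_⟩
  intro c x
  obtain ⟨x, rfl⟩ := Submodule.Quotient.mk_surjective _ x
  rw [khat_mk, qbdry_mk, khat_mk]
  exact bdry_chainMap _ _ (rankP_injective _) (rankP_injective _) _ _ _ (gamma_erase kap)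
    (fun σ hσ => ((gamma_iff _ _).1 hσ).2) (gamma_bd kap lam hcard) c x
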